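/- arXiv:1802.04026 — 2 statements merged into one kernel-verified Lean document; each statement's English description precedes it below -/
import Mathlib

section
/- If a ∈ H^∞ has inner-outer factorization a = u·a₀ with u inner and a₀ outer, then the range spaces coincide: T_{\bar{a}} H^2 = T_{\bar{a₀}} H^2. -/
open Complex Set

noncomputable section

/-- The open unit disk in `ℂ`. -/
def unitDisk : Set ℂ := Metric.ball 0 1

/-- The `n`-th Taylor coefficient of `f` at `0`. -/
def coef (f : ℂ → ℂ) (n : ℕ) : ℂ := iteratedDeriv n f 0 / (n.factorial : ℂ)

/-- `f` belongs to the Hardy space `H²` of the unit disk. -/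
def MemH2 (f : ℂ → ℂ) : Prop :=
  DifferentiableOn ℂ f unitDisk ∧ Summable fun n => ‖coef f n‖ ^ 2

/-- The `H²` norm. -/
def norm2 (f : ℂ → ℂ) : ℝ := Real.sqrt (∑' n, ‖coef f n‖ ^ 2)

/-- The `H²` inner product. -/
def inner2 (f g : ℂ → ℂ) : ℂ := ∑' n, coef f n * (starRingEnd ℂ) (coef g n)

/-- `f` belongs to `H^∞`: bounded and analytic on the unit disk. -/
def MemHinf (f : ℂ → ℂ) : Prop :=
  DifferentiableOn ℂ f unitDisk ∧ ∃ C, ∀ z ∈ unitDisk, ‖f z‖ ≤ C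

/-- The `H^∞` (sup) norm. -/
def normInf (f : ℂ → ℂ) : ℝ := sSup ((fun z => ‖f z‖) '' unitDisk)

/-- The co-analytic Toeplitz operator `T_{\bar a}` in terms of Taylor
coefficients: the `n`-th coefficient of `T_{\bar a} f` is
`∑ₖ conj (â k) * f̂ (n + k)`. -/
def Tbar (a f : ℂ → ℂ) : ℂ → ℂ :=
  fun z => ∑' n : ℕ, (∑' k : ℕ, (starRingEnd ℂ) (coef a k) * coef f (n + k)) * z ^ n

/-- Membership in the range space `M(ā) = T_{\bar a} H²` (as functions on the disk). -/
def MemMbar (a g : ℂ → ℂ) : Prop :=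
  ∃ f, MemH2 f ∧ Set.EqOn g (Tbar a f) unitDisk

/-- The range norm on `M(ā)`: `‖T_{\bar a} f‖_{ā} = ‖f‖_{H²}`. -/
def normMbar (a g : ℂ → ℂ) : ℝ :=
  sInf {r | ∃ f, MemH2 f ∧ Set.EqOn g (Tbar a f) unitDisk ∧ r = norm2 f}

/-- `a` is outer: the analytic Toeplitz operator `T_a` (multiplication by `a`)
has dense range in `H²`. -/
def Outer (a : ℂ → ℂ) : Prop :=
  ∀ g, MemH2 g → ∀ ε > 0, ∃ f, MemH2 f ∧ norm2 (fun z => g z - a z * f z) < ε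

/-- `u` is inner: multiplication by `u` is isometric on `H²`. -/
def IsInner (u : ℂ → ℂ) : Prop :=
  MemHinf u ∧ ∀ f, MemH2 f → norm2 (fun z => u z * f z) = norm2 f

/-- `p` is (given by) a polynomial of degree `< N`, i.e. of degree at most `N - 1`. -/
def MemPoly (N : ℕ) (p : ℂ → ℂ) : Prop :=
  ∃ q : Polynomial ℂ, q.degree < (N : WithBot ℕ) ∧ ∀ z, p z = q.eval z

/-- `φ` is a multiplier from `M(ā₁)` to `M(ā₂)`. -/
def Mult (a₁ a₂ φ : ℂ → ℂ) : Prop :=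
  DifferentiableOn ℂ φ unitDisk ∧
    ∀ f, MemMbar a₁ f → MemMbar a₂ fun z => φ z * f z

/-- The backward shift `B f = (f - f 0) / z`. -/
def Bshift (f : ℂ → ℂ) : ℂ → ℂ :=
  fun z => if z = 0 then deriv f 0 else (f z - f 0) / z

/-- A function with a power series expansion on the unit disk has the formal power series. -/
theorem hasFPowerSeriesOnBall_of_hasSum {f : ℂ → ℂ} {c : ℕ → ℂ}
    (h : ∀ z ∈ unitDisk, HasSum (fun n => c n * z ^ n) (f z)) :
    HasFPowerSeriesOnBall f (FormalMultilinearSeries.ofScalars ℂ c) 0 1 where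
  r_le := by
    refine ENNReal.le_of_forall_nnreal_lt fun r hr => ?_
    have hr1 : (r : ℝ) < 1 := by exact_mod_cast hr
    refine FormalMultilinearSeries.le_radius_of_tendsto (l := 0) _ ?_
    have hz : ((r : ℝ) : ℂ) ∈ unitDisk := by simpa [unitDisk] using hr1
    have := (h _ hz).summable.tendsto_atTop_zero.norm
    simpa using this
  r_pos := one_pos
  hasSum := by
    intro y hy
    have hy' : y ∈ unitDisk := by
      rw [unitDisk, ← Metric.eball_ofReal]
      simpa using hy
    simpa [FormalMultilinearSeries.ofScalars_apply_eq, mul_comm] using h y hy'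

theorem coef_eq_of_hasSum {f : ℂ → ℂ} {c : ℕ → ℂ}
    (h : ∀ z ∈ unitDisk, HasSum (fun n => c n * z ^ n) (f z)) : coef f = c := by
  funext n
  have := (hasFPowerSeriesOnBall_of_hasSum h).factorial_smul (1 : ℂ) n
  rw [← iteratedDeriv_eq_iteratedFDeriv] at this
  have hn : (n.factorial : ℂ) ≠ 0 := by exact_mod_cast n.factorial_ne_zero
  rw [coef, ← this]
  simp
  field_simp

theorem differentiableOn_of_hasSum {f : ℂ → ℂ} {c : ℕ → ℂ}
    (h : ∀ z ∈ unitDisk, HasSum (fun n => c n * z ^ n) (f z)) :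
    DifferentiableOn ℂ f unitDisk := by
  have := (hasFPowerSeriesOnBall_of_hasSum h).differentiableOn
  rwa [← ENNReal.ofReal_one, Metric.eball_ofReal] at this

theorem hasSum_coef {f : ℂ → ℂ} (hf : DifferentiableOn ℂ f unitDisk) {z : ℂ}
    (hz : z ∈ unitDisk) : HasSum (fun n => coef f n * z ^ n) (f z) := by
  have := Complex.hasSum_taylorSeries_on_ball hf hz
  convert! this using 2 with n
  simp [coef]
  ring

theorem coef_congr {f g : ℂ → ℂ} (hg : DifferentiableOn ℂ g unitDisk)
    (h : EqOn f g unitDisk) : coef f = coef g :=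
  coef_eq_of_hasSum fun z hz => by rw [h hz]; exact hasSum_coef hg hz

theorem coef_add {f g : ℂ → ℂ} (hf : DifferentiableOn ℂ f unitDisk)
    (hg : DifferentiableOn ℂ g unitDisk) (n : ℕ) :
    coef (fun z => f z + g z) n = coef f n + coef g n := by
  refine congrFun (coef_eq_of_hasSum (c := fun n => coef f n + coef g n) fun z hz => ?_) n
  simpa [add_mul] using (hasSum_coef hf hz).add (hasSum_coef hg hz)

theorem coef_const_mul {f : ℂ → ℂ} (hf : DifferentiableOn ℂ f unitDisk) (a : ℂ) (n : ℕ) :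
    coef (fun z => a * f z) n = a * coef f n := by
  refine congrFun (coef_eq_of_hasSum (c := fun n => a * coef f n) fun z hz => ?_) n
  simpa [mul_assoc] using (hasSum_coef hf hz).mul_left a

theorem coef_pow_mul {f : ℂ → ℂ} (hf : DifferentiableOn ℂ f unitDisk) (n m : ℕ) :
    coef (fun z => z ^ n * f z) m = if n ≤ m then coef f (m - n) else 0 := by
  refine congrFun
    (coef_eq_of_hasSum (c := fun m => if n ≤ m then coef f (m - n) else 0) fun z hz => ?_) m
  have h := (hasSum_coef hf hz).mul_left (z ^ n)
  rw [← (add_left_injective n).hasSum_iff]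
  · convert! h using 2 with k
    simp [pow_add]
    ring
  · intro k hk
    have : ¬ n ≤ k := fun hle => hk ⟨k - n, by simp [hle]⟩
    simp [this]

/-- Parseval's inequality on the circle of radius `r < 1`. -/
theorem sum_norm_coef_mul_pow_sq_le {f : ℂ → ℂ} (hf : DifferentiableOn ℂ f unitDisk) {C : ℝ}
    (hC : ∀ z ∈ unitDisk, ‖f z‖ ≤ C) {r : ℝ} (hr0 : 0 ≤ r) (hr1 : r < 1) (s : Finset ℕ) :
    ∑ n ∈ s, ‖coef f n * (r : ℂ) ^ n‖ ^ 2 ≤ C ^ 2 := by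
  have hmem (t : UnitAddCircle) : (r : ℂ) * fourier 1 t ∈ unitDisk := by
    simp [unitDisk, abs_of_nonneg hr0, Circle.norm_coe, hr1]
  let F : C(UnitAddCircle, ℂ) :=
    ⟨fun t => f (r * fourier 1 t), hf.continuousOn.comp_continuous (by fun_prop) hmem⟩
  have hC0 : 0 ≤ C := (norm_nonneg _).trans (hC _ (hmem 0))
  have hF : ‖F‖ ≤ C := (ContinuousMap.norm_le _ hC0).2 fun t => hC _ (hmem t)
  have hterm (n : ℕ) (t : UnitAddCircle) :
      coef f n * ((r : ℂ) * fourier 1 t) ^ n = coef f n * (r : ℂ) ^ n * fourier (n : ℤ) t := by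
    simp [fourier_apply, mul_pow, mul_assoc, AddCircle.toCircle_nsmul]
  have hsummable : Summable fun n : ℕ => (coef f n * (r : ℂ) ^ n) •
      (fourier (n : ℤ) : C(UnitAddCircle, ℂ)) := by
    refine Summable.of_norm ?_
    simp_rw [norm_smul, fourier_norm, mul_one]
    exact (hasSum_coef hf (by simpa [unitDisk, abs_of_nonneg hr0] using hr1)).summable.norm
  have hsum : HasSum (fun n : ℕ => (coef f n * (r : ℂ) ^ n) •
      (fourier (n : ℤ) : C(UnitAddCircle, ℂ))) F := by
    convert hsummable.hasSum
    ext t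
    have h1 := ContinuousMap.hasSum_apply hsummable.hasSum t
    have h2 := hasSum_coef hf (hmem t)
    simp_rw [hterm] at h2
    exact h2.unique (by simpa using h1)
  let L : C(UnitAddCircle, ℂ) →L[ℂ] MeasureTheory.Lp ℂ 2 (AddCircle.haarAddCircle (T := 1)) :=
    ContinuousMap.toLp 2 AddCircle.haarAddCircle ℂ
  have hL : ‖L F‖ ≤ C := by
    have h1 := ContinuousMap.toLp_norm_le (p := 2) (E := ℂ) (𝕜 := ℂ)
      (AddCircle.haarAddCircle (T := 1))
    have h2 := L.le_of_opNorm_le h1 F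
    simp [MeasureTheory.measureUnivNNReal] at h2
    exact h2.trans hF
  have hon : Orthonormal ℂ fun n : ℕ => fourierLp (T := 1) 2 (n : ℤ) :=
    orthonormal_fourier.comp _ Nat.cast_injective
  have hLsum := hsum.mapL L
  have hinner (n : ℕ) : inner ℂ (fourierLp (T := 1) 2 (n : ℤ)) (L F) = coef f n * (r : ℂ) ^ n := by
    have h1 := hLsum.mapL (innerSL ℂ (fourierLp (T := 1) 2 (n : ℤ)))
    refine h1.unique ?_
    convert! hasSum_ite_eq n (coef f n * (r : ℂ) ^ n) using 2 with m
    have h2 := orthonormal_iff_ite.1 hon n m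
    simp only [map_smul, innerSL_apply_apply]
    change _ • inner ℂ (fourierLp (T := 1) 2 (n : ℤ)) (fourierLp (T := 1) 2 (m : ℤ)) = _
    rw [h2]
    rcases eq_or_ne n m with rfl | hnm
    · simp
    · simp [hnm, hnm.symm]
  calc ∑ n ∈ s, ‖coef f n * (r : ℂ) ^ n‖ ^ 2 ≤ ‖L F‖ ^ 2 := by
        simpa only [hinner] using hon.sum_inner_products_le (L F) (s := s)
    _ ≤ C ^ 2 := by gcongr

theorem MemHinf.memH2 {f : ℂ → ℂ} (hf : MemHinf f) : MemH2 f := by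
  obtain ⟨hd, C, hC⟩ := hf
  refine ⟨hd, summable_of_sum_le (c := C ^ 2) (fun n => by positivity) fun s => ?_⟩
  have hcont : Filter.Tendsto (fun r : ℝ => ∑ n ∈ s, ‖coef f n * (r : ℂ) ^ n‖ ^ 2)
      (nhdsWithin 1 (Iio 1)) (nhds (∑ n ∈ s, ‖coef f n * ((1 : ℝ) : ℂ) ^ n‖ ^ 2)) :=
    (Continuous.tendsto (by fun_prop) 1).mono_left nhdsWithin_le_nhds
  simp only [ofReal_one, one_pow, mul_one] at hcont
  refine le_of_tendsto hcont ?_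
  filter_upwards [Ioo_mem_nhdsLT (zero_lt_one' ℝ)] with r hr
  exact sum_norm_coef_mul_pow_sq_le hd hC hr.1.le hr.2 s

theorem MemHinf.pow_mul {f : ℂ → ℂ} (hf : MemHinf f) (n : ℕ) : MemHinf fun z => z ^ n * f z := by
  obtain ⟨hd, C, hC⟩ := hf
  refine ⟨by fun_prop, C, fun z hz => ?_⟩
  have hz1 : ‖z‖ ≤ 1 := by simpa [unitDisk] using (mem_ball_zero_iff.1 hz).le
  rw [norm_mul, norm_pow]
  exact (mul_le_of_le_one_left (norm_nonneg _) (pow_le_one₀ (norm_nonneg _) hz1)).trans (hC z hz)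

/-- The space of square-summable coefficient sequences. -/
abbrev EllTwo : Type := lp (fun _ : ℕ => ℂ) 2

theorem memℓp_two_iff {c : ℕ → ℂ} : Memℓp c 2 ↔ Summable fun n => ‖c n‖ ^ 2 := by
  rw [memℓp_gen_iff (by norm_num)]
  norm_num

/-- The coefficient sequence of an `H²` function. -/
def MemH2.toEllTwo {f : ℂ → ℂ} (hf : MemH2 f) : EllTwo := ⟨coef f, memℓp_two_iff.2 hf.2⟩

@[simp]
theorem MemH2.toEllTwo_apply {f : ℂ → ℂ} (hf : MemH2 f) (n : ℕ) : hf.toEllTwo n = coef f n := rfl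

theorem MemH2.norm_toEllTwo {f : ℂ → ℂ} (hf : MemH2 f) : ‖hf.toEllTwo‖ = norm2 f := by
  rw [lp.norm_eq_tsum_rpow (by norm_num), norm2, Real.sqrt_eq_rpow]
  norm_num

/-- The power series with the given coefficients. -/
def powerSum (c : ℕ → ℂ) (z : ℂ) : ℂ := ∑' n, c n * z ^ n

theorem hasSum_powerSum (x : EllTwo) {z : ℂ} (hz : z ∈ unitDisk) :
    HasSum (fun n => x n * z ^ n) (powerSum x z) := by
  refine Summable.hasSum (Summable.of_norm_bounded (g := fun n => ‖x‖ * ‖z‖ ^ n) ?_ fun n => ?_)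
  · exact (summable_geometric_of_lt_one (norm_nonneg _) (mem_ball_zero_iff.1 hz)).mul_left _
  · rw [norm_mul, norm_pow]
    gcongr
    exact lp.norm_apply_le_norm (by norm_num) x n

theorem coef_powerSum (x : EllTwo) : coef (powerSum x) = x :=
  coef_eq_of_hasSum fun _ hz => hasSum_powerSum x hz

theorem memH2_powerSum (x : EllTwo) : MemH2 (powerSum x) :=
  ⟨differentiableOn_of_hasSum fun _ hz => hasSum_powerSum x hz, by
    rw [coef_powerSum]; exact memℓp_two_iff.1 x.2⟩

theorem toEllTwo_powerSum (x : EllTwo) : (memH2_powerSum x).toEllTwo = x :=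
  lp.ext (coef_powerSum x)

theorem eqOn_powerSum {f : ℂ → ℂ} (hf : MemH2 f) : EqOn (powerSum (coef f)) f unitDisk :=
  fun _ hz => (hasSum_coef hf.1 hz).tsum_eq

theorem IsInner.memH2_mul {u f : ℂ → ℂ} (hu : IsInner u) (hf : MemH2 f) :
    MemH2 fun z => u z * f z := by
  have hd : DifferentiableOn ℂ (fun z => u z * f z) unitDisk := hu.1.1.mul hf.1
  refine ⟨hd, ?_⟩
  by_contra hns
  have hnorm := hu.2 f hf
  rw [norm2, tsum_eq_zero_of_not_summable hns, Real.sqrt_zero, ← hf.norm_toEllTwo, eq_comm,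
    norm_eq_zero] at hnorm
  have hf0 : EqOn (fun z => u z * f z) (fun _ => 0) unitDisk := fun z hz => by
    have hz0 := eqOn_powerSum hf hz
    have hc (n : ℕ) : coef f n = 0 := by rw [← hf.toEllTwo_apply, hnorm]; rfl
    simp only [powerSum, hc, zero_mul, tsum_zero] at hz0
    simp [← hz0]
  have hc : coef (fun z => u z * f z) = fun _ => 0 :=
    coef_eq_of_hasSum fun z hz => by simp [hf0 hz]
  exact hns (by simp [hc, summable_zero])

/-- Multiplication by an inner function as an isometry of the coefficient space. -/
def IsInner.mulIsometry {u : ℂ → ℂ} (hu : IsInner u) : EllTwo →ₗᵢ[ℂ] EllTwo where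
  toFun x := (hu.memH2_mul (memH2_powerSum x)).toEllTwo
  map_add' x y := by
    have hx := hu.memH2_mul (memH2_powerSum x)
    have hy := hu.memH2_mul (memH2_powerSum y)
    refine lp.ext (funext fun n => ?_)
    simp only [MemH2.toEllTwo_apply, lp.coeFn_add, Pi.add_apply]
    rw [← coef_add hx.1 hy.1]
    refine congrFun (coef_congr (hx.1.add hy.1) fun z hz => ?_) n
    have h := (hasSum_powerSum x hz).add (hasSum_powerSum y hz)
    have h' : powerSum (x + y : EllTwo) z = powerSum x z + powerSum y z :=
      (hasSum_powerSum (x + y) hz).unique (by simpa [add_mul] using h)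
    change u z * powerSum (x + y : EllTwo) z = u z * powerSum x z + u z * powerSum y z
    rw [h', mul_add]
  map_smul' a x := by
    have hx := hu.memH2_mul (memH2_powerSum x)
    refine lp.ext (funext fun n => ?_)
    simp only [MemH2.toEllTwo_apply, lp.coeFn_smul, Pi.smul_apply, RingHom.id_apply, smul_eq_mul]
    rw [← coef_const_mul hx.1]
    refine congrFun (coef_congr (hx.1.const_mul a) fun z hz => ?_) n
    have h := (hasSum_powerSum x hz).mul_left a
    have h' : powerSum (a • x : EllTwo) z = a * powerSum x z :=
      (hasSum_powerSum (a • x) hz).unique (by simpa [mul_assoc] using h)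
    change u z * powerSum (a • x : EllTwo) z = a * (u z * powerSum x z)
    rw [h']
    ring
  norm_map' x := by
    change ‖(hu.memH2_mul (memH2_powerSum x)).toEllTwo‖ = ‖x‖
    rw [MemH2.norm_toEllTwo, hu.2 _ (memH2_powerSum x), ← MemH2.norm_toEllTwo (memH2_powerSum x),
      toEllTwo_powerSum]

theorem IsInner.mulIsometry_toEllTwo {u f g : ℂ → ℂ} (hu : IsInner u) (hf : MemH2 f)
    (hg : MemH2 g) (h : EqOn g (fun z => u z * f z) unitDisk) :
    hu.mulIsometry hf.toEllTwo = hg.toEllTwo := by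
  refine lp.ext (coef_congr hg.1 fun z hz => ?_)
  change u z * powerSum (coef f) z = g z
  rw [eqOn_powerSum hf hz, h hz]

/-- The coefficients of `T_{\bar a} f` are inner products with the shifts `zⁿ a`. -/
theorem tsum_conj_coef_mul_eq_inner {a f : ℂ → ℂ} (ha : MemHinf a) (hf : MemH2 f) (n : ℕ) :
    ∑' k : ℕ, (starRingEnd ℂ) (coef a k) * coef f (n + k) =
      inner ℂ (ha.pow_mul n).memH2.toEllTwo hf.toEllTwo := by
  rw [lp.inner_eq_tsum, ← (add_right_injective n).tsum_eq (f := fun m =>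
    inner ℂ ((ha.pow_mul n).memH2.toEllTwo m) (hf.toEllTwo m))]
  · refine tsum_congr fun k => ?_
    simp only [MemH2.toEllTwo_apply, coef_pow_mul ha.1, RCLike.inner_apply]
    simp [mul_comm]
  · intro m hm
    by_contra hmn
    have : ¬ n ≤ m := fun hle => hmn ⟨m - n, by simp [hle]⟩
    simp [coef_pow_mul ha.1, this] at hm

theorem memMbar_iff {a : ℂ → ℂ} (ha : MemHinf a) (g : ℂ → ℂ) :
    MemMbar a g ↔ ∃ x : EllTwo, EqOn g
      (powerSum fun n => inner ℂ (ha.pow_mul n).memH2.toEllTwo x) unitDisk := by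
  constructor
  · rintro ⟨f, hf, hg⟩
    refine ⟨hf.toEllTwo, fun z hz => ?_⟩
    simp only [hg hz, Tbar, tsum_conj_coef_mul_eq_inner ha hf, powerSum]
  · rintro ⟨x, hg⟩
    refine ⟨powerSum x, memH2_powerSum x, fun z hz => ?_⟩
    simp only [hg hz, Tbar, tsum_conj_coef_mul_eq_inner ha (memH2_powerSum x),
      toEllTwo_powerSum, powerSum]

/-- if `a = u·a₀` with `u` inner and `a₀` outer, then
`T_{\bar a} H² = T_{\bar{a₀}} H²`. -/
theorem stmt2 (a u a₀ : ℂ → ℂ) (ha : MemHinf a) (hu : IsInner u)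
    (ha₀ : MemHinf a₀) (hout : Outer a₀)
    (hfac : ∀ z ∈ unitDisk, a z = u z * a₀ z) :
    ∀ g, MemMbar a g ↔ MemMbar a₀ g := by
  intro g
  have hshift (n : ℕ) : hu.mulIsometry (ha₀.pow_mul n).memH2.toEllTwo =
      (ha.pow_mul n).memH2.toEllTwo :=
    hu.mulIsometry_toEllTwo _ _ fun z hz => by
      simp only [hfac z hz]
      ring
  rw [memMbar_iff ha, memMbar_iff ha₀]
  constructor
  · rintro ⟨x, hx⟩
    refine ⟨hu.mulIsometry.toContinuousLinearMap.adjoint x, ?_⟩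
    simpa only [ContinuousLinearMap.adjoint_inner_right, LinearIsometry.coe_toContinuousLinearMap,
      hshift] using hx
  · rintro ⟨x, hx⟩
    refine ⟨hu.mulIsometry x, ?_⟩
    simpa only [← hshift, LinearIsometry.inner_map_map] using hx
end
end

section
/- Let a₁, a₂ be polynomials with all zeros on the unit circle and suppose h = a₁/a₂ ∈ H^∞. Then the multipliers from M(\bar{a₁}) to M(\bar{a₂}) are exactly 𝔐(\bar{a₁}, \bar{a₂}) = { φ ∈ M(\bar{a₂}) : hφ ∈ H^∞ }. -/
open Complex Set

noncomputable section

open PowerSeries (coeff)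
open Filter Topology

/-- The power series `F` converges to `f` on the unit disk. -/
def IsTaylor (F : PowerSeries ℂ) (f : ℂ → ℂ) : Prop :=
  ∀ z ∈ unitDisk, HasSum (fun n => coeff n F * z ^ n) (f z)

/-- The Taylor series of `f` at `0`. -/
def taylorPS (f : ℂ → ℂ) : PowerSeries ℂ := PowerSeries.mk (coef f)

lemma mem_unitDisk {z : ℂ} : z ∈ unitDisk ↔ ‖z‖ < 1 := by simp [unitDisk]

lemma coeff_taylorPS (f : ℂ → ℂ) (n : ℕ) : coeff n (taylorPS f) = coef f n := by
  simp [taylorPS]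

lemma isTaylor_taylorPS {f : ℂ → ℂ} (hf : DifferentiableOn ℂ f unitDisk) :
    IsTaylor (taylorPS f) f := by
  intro z hz
  refine (Complex.hasSum_taylorSeries_on_ball hf hz).congr_fun fun n => ?_
  simp only [coeff_taylorPS, coef, sub_zero, smul_eq_mul]
  ring

namespace IsTaylor

variable {F G : PowerSeries ℂ} {f g : ℂ → ℂ}

lemma congr (hF : IsTaylor F f) (h : Set.EqOn g f unitDisk) : IsTaylor F g := fun z hz => by
  rw [h hz]; exact hF z hz

lemma hasFPowerSeriesOnBall (hF : IsTaylor F f) :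
    HasFPowerSeriesOnBall f (FormalMultilinearSeries.ofScalars ℂ fun n => coeff n F) 0 1 where
  r_le := by
    refine ENNReal.le_of_forall_nnreal_lt fun r hr => ?_
    apply FormalMultilinearSeries.le_radius_of_summable
    have hr1 : (r : ℝ) < 1 := by exact_mod_cast hr
    have := (hF (r : ℂ) (by simpa [mem_unitDisk] using hr1)).summable.norm
    refine this.congr fun n => ?_
    simp
  r_pos := one_pos
  hasSum := by
    intro y hy
    have hy' : y ∈ unitDisk := by
      rw [mem_unitDisk]
      simpa [edist_zero_right, enorm, ← NNReal.coe_lt_coe] using hy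
    simpa [FormalMultilinearSeries.ofScalars_apply_eq, mul_comm] using hF y hy'

lemma differentiableOn (hF : IsTaylor F f) : DifferentiableOn ℂ f unitDisk := by
  have := hF.hasFPowerSeriesOnBall.differentiableOn
  rwa [← ENNReal.coe_one, Metric.eball_coe] at this

lemma unique (hF : IsTaylor F f) (hG : IsTaylor G f) : F = G := by
  have := hF.hasFPowerSeriesOnBall.hasFPowerSeriesAt.eq_formalMultilinearSeries
    hG.hasFPowerSeriesOnBall.hasFPowerSeriesAt
  rw [FormalMultilinearSeries.ofScalars_series_eq_iff] at this
  ext n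
  exact congrFun this n

lemma taylorPS_eq (hF : IsTaylor F f) : taylorPS f = F :=
  (isTaylor_taylorPS hF.differentiableOn).unique hF

lemma coef_eq (hF : IsTaylor F f) (n : ℕ) : coef f n = coeff n F := by
  rw [← hF.taylorPS_eq, coeff_taylorPS]

lemma add (hF : IsTaylor F f) (hG : IsTaylor G g) : IsTaylor (F + G) fun z => f z + g z := by
  intro z hz
  simpa [add_mul] using (hF z hz).add (hG z hz)

lemma mul (hF : IsTaylor F f) (hG : IsTaylor G g) : IsTaylor (F * G) fun z => f z * g z := by
  intro z hz
  have hf := (hF z hz).summable.norm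
  have hg := (hG z hz).summable.norm
  have hs := (summable_norm_sum_mul_antidiagonal_of_summable_norm hf hg).of_norm.hasSum
  rw [← tsum_mul_tsum_eq_tsum_sum_antidiagonal_of_summable_norm hf hg, (hF z hz).tsum_eq,
    (hG z hz).tsum_eq] at hs
  refine hs.congr_fun fun n => ?_
  rw [PowerSeries.coeff_mul, Finset.sum_mul]
  refine Finset.sum_congr rfl fun x hx => ?_
  rw [← Finset.HasAntidiagonal.mem_antidiagonal.mp hx, pow_add]
  ring

lemma polynomial (p : Polynomial ℂ) : IsTaylor (p : PowerSeries ℂ) fun z => p.eval z := by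
  intro z _
  beta_reduce
  rw [Polynomial.eval_eq_sum_range]
  simp only [Polynomial.coeff_coe]
  refine hasSum_sum_of_ne_finset_zero fun n hn => ?_
  rw [Polynomial.coeff_eq_zero_of_natDegree_lt (by simpa using hn), zero_mul]

end IsTaylor

lemma memH2_iff {F : PowerSeries ℂ} {f : ℂ → ℂ} (hF : IsTaylor F f) :
    MemH2 f ↔ Summable fun n => ‖coeff n F‖ ^ 2 := by
  simp [MemH2, hF.differentiableOn, hF.coef_eq]

lemma MemH2.congr {f g : ℂ → ℂ} (hf : MemH2 f) (h : Set.EqOn g f unitDisk) : MemH2 g := by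
  have := isTaylor_taylorPS hf.1
  exact (memH2_iff (this.congr h)).2 ((memH2_iff this).1 hf)

lemma MemH2.add {f g : ℂ → ℂ} (hf : MemH2 f) (hg : MemH2 g) : MemH2 fun z => f z + g z := by
  have hF := isTaylor_taylorPS hf.1
  have hG := isTaylor_taylorPS hg.1
  rw [memH2_iff (hF.add hG)]
  have h1 := (memH2_iff hF).1 hf
  have h2 := (memH2_iff hG).1 hg
  refine Summable.of_nonneg_of_le (fun n => by positivity) (fun n => ?_)
    ((h1.add h2).mul_left 2)
  rw [map_add]
  have h3 := norm_add_le (coeff n (taylorPS f)) (coeff n (taylorPS g))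
  have h4 : 0 ≤ ‖coeff n (taylorPS f) + coeff n (taylorPS g)‖ := norm_nonneg _
  nlinarith [sq_nonneg (‖coeff n (taylorPS f)‖ - ‖coeff n (taylorPS g)‖)]

lemma memH2_polynomial (p : Polynomial ℂ) : MemH2 fun z => p.eval z := by
  rw [memH2_iff (IsTaylor.polynomial p)]
  refine summable_of_ne_finset_zero (s := Finset.range (p.natDegree + 1)) fun n hn => ?_
  rw [Polynomial.coeff_coe, Polynomial.coeff_eq_zero_of_natDegree_lt (by simpa using hn)]
  simp

/-- A square summable power series converges on the disk, to an `H²` function. -/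
lemma exists_memH2_of_summable {F : PowerSeries ℂ} (hF : Summable fun n => ‖coeff n F‖ ^ 2) :
    ∃ f, MemH2 f ∧ IsTaylor F f := by
  have : IsTaylor F fun z => ∑' n, coeff n F * z ^ n := by
    intro z hz
    apply Summable.hasSum
    rw [mem_unitDisk] at hz
    have h1 : Summable fun n : ℕ => (‖z‖ ^ 2) ^ n :=
      summable_geometric_of_lt_one (by positivity) (by nlinarith [norm_nonneg z])
    refine Summable.of_norm_bounded (hF.add h1) fun n => ?_
    rw [norm_mul, norm_pow, ← pow_mul, mul_comm 2 n, pow_mul]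
    nlinarith [sq_nonneg (‖coeff n F‖ - ‖z‖ ^ n), sq_nonneg (‖coeff n F‖), sq_nonneg (‖z‖ ^ n)]
  exact ⟨_, (memH2_iff this).2 hF, this⟩

/-- Parseval's identity for an absolutely convergent power series on the unit circle. -/
lemma tendsto_sum_sq_norm_circleAverage {c : ℕ → ℂ} (hc : Summable fun n => ‖c n‖) {g : ℂ → ℂ}
    (hg : ∀ z, ‖z‖ = 1 → HasSum (fun n => c n * z ^ n) (g z)) :
    Tendsto (fun M => ∑ n ∈ Finset.range M, ‖c n‖ ^ 2) atTop
      (𝓝 (Real.circleAverage (fun z => ‖g z‖ ^ 2) 0 1)) := by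
  set P : ℕ → Polynomial ℂ := fun M => PowerSeries.trunc M (PowerSeries.mk c) with hP
  have heval : ∀ M z, (P M).eval z = ∑ n ∈ Finset.range M, c n * z ^ n := by
    intro M z
    rw [hP, ← Polynomial.eval₂_id, PowerSeries.eval₂_trunc_eq_sum_range]
    simp
  have hsum : ∀ M, ∑ n ∈ Finset.range M, ‖c n‖ ^ 2 =
      Real.circleAverage (fun z => ‖(P M).eval z‖ ^ 2) 0 1 := by
    intro M
    rw [← Polynomial.sum_sq_norm_coeff_eq_circleAverage]
    symm
    apply Finset.sum_subset_zero_on_sdiff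
    · intro i hi
      rw [Polynomial.mem_support_iff, PowerSeries.coeff_trunc] at hi
      simp only [Finset.mem_range]
      by_contra h
      simp [h] at hi
    · intro i hi
      have := (Finset.mem_sdiff.mp hi).2
      rw [Polynomial.notMem_support_iff, PowerSeries.coeff_trunc,
        if_pos (Finset.mem_range.mp (Finset.mem_sdiff.mp hi).1)] at this
      simp_all
    · intro i hi
      rw [Polynomial.mem_support_iff, PowerSeries.coeff_trunc] at hi
      rw [PowerSeries.coeff_trunc]
      split_ifs with h
      · simp
      · simp [h] at hi
  simp_rw [hsum, Real.circleAverage_def]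
  refine Tendsto.const_smul ?_ _
  refine intervalIntegral.tendsto_integral_filter_of_dominated_convergence
    (fun _ => (∑' n, ‖c n‖) ^ 2) ?_ ?_ (by simp) ?_
  · refine Eventually.of_forall fun M => Continuous.aestronglyMeasurable ?_
    have := (P M).continuous
    fun_prop
  · refine Eventually.of_forall fun M => Eventually.of_forall fun θ _ => ?_
    rw [Real.norm_of_nonneg (by positivity), heval]
    gcongr
    refine (norm_sum_le _ _).trans ?_
    simp only [norm_mul, norm_pow, norm_circleMap_zero, abs_one, one_pow, mul_one]
    exact hc.sum_le_tsum _ fun _ _ => norm_nonneg _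
  · refine Eventually.of_forall fun θ _ => ?_
    simp_rw [heval]
    exact ((hg _ (by simp)).tendsto_sum_nat.norm).pow 2

lemma IsTaylor.parseval {F : PowerSeries ℂ} {f : ℂ → ℂ} (hF : IsTaylor F f) {r : ℝ}
    (h0 : 0 ≤ r) (h1 : r < 1) :
    Tendsto (fun M => ∑ n ∈ Finset.range M, ‖coeff n F * r ^ n‖ ^ 2) atTop
      (𝓝 (Real.circleAverage (fun z => ‖f (r * z)‖ ^ 2) 0 1)) := by
  apply tendsto_sum_sq_norm_circleAverage
  · exact (hF r (by simpa [mem_unitDisk, abs_of_nonneg h0] using h1)).summable.norm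
  · intro z hz
    have := hF (r * z) (by simpa [mem_unitDisk, abs_of_nonneg h0, hz] using h1)
    simpa [mul_pow, mul_assoc] using this

lemma circleIntegrable_sq_norm_dilation {f : ℂ → ℂ} (hf : DifferentiableOn ℂ f unitDisk) {r : ℝ}
    (h0 : 0 ≤ r) (h1 : r < 1) : CircleIntegrable (fun z => ‖f (r * z)‖ ^ 2) 0 1 := by
  apply ContinuousOn.circleIntegrable zero_le_one
  refine (ContinuousOn.norm (hf.continuousOn.comp (by fun_prop) fun z hz => ?_)).pow 2
  rw [mem_sphere_zero_iff_norm] at hz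
  simpa [mem_unitDisk, abs_of_nonneg h0, hz] using h1

/-- Bounded analytic functions multiply `H²`. -/
lemma MemHinf.mul_memH2 {u f : ℂ → ℂ} (hu : MemHinf u) (hf : MemH2 f) :
    MemH2 fun z => u z * f z := by
  obtain ⟨hud, C, hC⟩ := hu
  have hF := isTaylor_taylorPS hf.1
  have hUF := (isTaylor_taylorPS hud).mul hF
  have hs := (memH2_iff hF).1 hf
  rw [memH2_iff hUF]
  set S := ∑' n, ‖coeff n (taylorPS f)‖ ^ 2
  set G := taylorPS u * taylorPS f
  have key : ∀ r ∈ Set.Ico (0 : ℝ) 1, ∀ M,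
      ∑ n ∈ Finset.range M, ‖coeff n G * (r : ℂ) ^ n‖ ^ 2 ≤ C ^ 2 * S := by
    rintro r ⟨h0, h1⟩ M
    have e1 : ∑ n ∈ Finset.range M, ‖coeff n G * (r : ℂ) ^ n‖ ^ 2 ≤
        Real.circleAverage (fun z => ‖u (r * z) * f (r * z)‖ ^ 2) 0 1 := by
      refine Monotone.ge_of_tendsto (fun a b hab => ?_) (hUF.parseval h0 h1) M
      exact Finset.sum_le_sum_of_subset_of_nonneg (Finset.range_mono hab)
        fun _ _ _ => by positivity
    have e2 : Real.circleAverage (fun z => ‖u (r * z) * f (r * z)‖ ^ 2) 0 1 ≤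
        Real.circleAverage (fun z => C ^ 2 • ‖f (r * z)‖ ^ 2) 0 1 := by
      apply Real.circleAverage_mono (circleIntegrable_sq_norm_dilation hUF.differentiableOn h0 h1)
      · exact (circleIntegrable_sq_norm_dilation hf.1 h0 h1).const_smul
      · intro z hz
        rw [abs_one, mem_sphere_zero_iff_norm] at hz
        have := hC (r * z) (by simpa [mem_unitDisk, abs_of_nonneg h0, hz] using h1)
        simp only [norm_mul (u _), mul_pow, smul_eq_mul]
        gcongr
    have e3 : Real.circleAverage (fun z => ‖f (r * z)‖ ^ 2) 0 1 ≤ S := by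
      refine le_of_tendsto (hF.parseval h0 h1) (Eventually.of_forall fun N => ?_)
      refine (Finset.sum_le_sum fun n _ => ?_).trans
        (hs.sum_le_tsum (Finset.range N) fun _ _ => by positivity)
      rw [norm_mul, norm_pow, Complex.norm_of_nonneg h0]
      have := pow_le_one₀ (n := n) h0 h1.le
      gcongr
      exact mul_le_of_le_one_right (norm_nonneg _) this
    rw [Real.circleAverage_fun_smul, smul_eq_mul] at e2
    exact (e1.trans e2).trans (by gcongr)
  refine summable_of_sum_range_le (c := C ^ 2 * S) (fun _ => by positivity) fun M => ?_
  have hlim : Tendsto (fun r : ℝ => ∑ n ∈ Finset.range M, ‖coeff n G * (r : ℂ) ^ n‖ ^ 2)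
      (𝓝[<] 1) (𝓝 (∑ n ∈ Finset.range M, ‖coeff n G‖ ^ 2)) := by
    have : Continuous fun r : ℝ => ∑ n ∈ Finset.range M, ‖coeff n G * (r : ℂ) ^ n‖ ^ 2 := by
      fun_prop
    simpa using (this.tendsto 1).mono_left nhdsWithin_le_nhds
  refine le_of_tendsto hlim ?_
  filter_upwards [Ico_mem_nhdsLT (zero_lt_one' ℝ)] with r hr using key r hr M

lemma memHinf_polynomial (p : Polynomial ℂ) : MemHinf fun z => p.eval z := by
  refine ⟨p.differentiable.differentiableOn, ?_⟩
  obtain ⟨C, hC⟩ := (isCompact_closedBall (0 : ℂ) 1).exists_bound_of_continuousOn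
    p.continuous.continuousOn
  exact ⟨C, fun z hz => hC z (Metric.ball_subset_closedBall hz)⟩

/-- The Szegő kernel at `w`, as a square summable sequence. -/
def szego (w : ℂ) (hw : w ∈ unitDisk) : lp (fun _ : ℕ => ℂ) 2 :=
  ⟨fun n => (starRingEnd ℂ) w ^ n, by
    rw [mem_unitDisk] at hw
    apply memℓp_gen
    simp only [norm_pow, RCLike.norm_conj, ENNReal.toReal_ofNat, Real.rpow_ofNat, ← pow_mul']
    simp only [pow_mul]
    exact summable_geometric_of_lt_one (by positivity) (by nlinarith [norm_nonneg w])⟩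

/-- The Taylor coefficients of an `H²` function, as a square summable sequence. -/
def MemH2.toL2 {f : ℂ → ℂ} (hf : MemH2 f) : lp (fun _ : ℕ => ℂ) 2 :=
  ⟨coef f, memℓp_gen (by simpa using hf.2)⟩

lemma MemH2.inner_szego {f : ℂ → ℂ} (hf : MemH2 f) {w : ℂ} (hw : w ∈ unitDisk) :
    inner ℂ (szego w hw) hf.toL2 = f w := by
  rw [lp.inner_eq_tsum, ← (isTaylor_taylorPS hf.1 w hw).tsum_eq]
  refine tsum_congr fun n => ?_
  simp [szego, MemH2.toL2, coeff_taylorPS]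

lemma exists_toL2_eq (x : lp (fun _ : ℕ => ℂ) 2) : ∃ (f : ℂ → ℂ) (hf : MemH2 f), hf.toL2 = x := by
  obtain ⟨f, hf, hF⟩ := exists_memH2_of_summable (F := PowerSeries.mk x)
    (by simpa using (memℓp_gen_iff (by simp)).1 (lp.memℓp x))
  refine ⟨f, hf, ?_⟩
  ext n
  simp [MemH2.toL2, hF.coef_eq]

lemma norm_szego_sq {w : ℂ} (hw : w ∈ unitDisk) : ‖szego w hw‖ ^ 2 = (1 - ‖w‖ ^ 2)⁻¹ := by
  have := lp.norm_rpow_eq_tsum (p := 2) (by simp) (szego w hw)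
  simp only [ENNReal.toReal_ofNat, Real.rpow_ofNat] at this
  rw [this, ← tsum_geometric_of_lt_one (by positivity)
    (by rw [mem_unitDisk] at hw; nlinarith [norm_nonneg w])]
  refine tsum_congr fun n => ?_
  simp [szego, ← pow_mul, mul_comm]

lemma norm_szego_pos {w : ℂ} (hw : w ∈ unitDisk) : 0 < ‖szego w hw‖ := by
  have h := norm_szego_sq hw
  rw [mem_unitDisk] at hw
  have h2 : 0 < (1 - ‖w‖ ^ 2)⁻¹ := by
    rw [inv_pos]; nlinarith [norm_nonneg w]
  rw [← h] at h2
  exact (norm_nonneg _).lt_of_ne' (sq_pos_iff.1 h2)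

lemma ofReal_mul_mem_unitDisk {ζ : ℂ} (hζ : ‖ζ‖ = 1) {r : ℝ} (hr : r ∈ Set.Ico (0 : ℝ) 1) :
    (r : ℂ) * ζ ∈ unitDisk := by
  simpa [mem_unitDisk, hζ, abs_of_nonneg hr.1] using hr.2

/-- Radial growth of `H²` functions is `o((1 - r)^{-1/2})`. -/
lemma MemH2.tendsto_sqrt_mul_norm {f : ℂ → ℂ} (hf : MemH2 f) {ζ : ℂ} (hζ : ‖ζ‖ = 1) :
    Tendsto (fun r : ℝ => √(1 - r) * ‖f (r * ζ)‖) (𝓝[<] 1) (𝓝 0) := by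
  rw [Metric.tendsto_nhds]
  intro ε hε
  have hx := lp.hasSum_single (p := 2) (by simp) hf.toL2
  obtain ⟨s, hs⟩ := ((Metric.tendsto_nhds.1 hx) (ε / 2) (half_pos hε)).exists
  set y := ∑ i ∈ s, lp.single 2 i (hf.toL2 i) with hy
  set B := ∑ i ∈ s, ‖hf.toL2 i‖ with hB
  have hlim : Tendsto (fun r : ℝ => √(1 - r) * B) (𝓝[<] 1) (𝓝 0) := by
    have : Continuous fun r : ℝ => √(1 - r) * B := by fun_prop
    simpa using (this.tendsto 1).mono_left nhdsWithin_le_nhds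
  filter_upwards [Ico_mem_nhdsLT (zero_lt_one' ℝ), hlim.eventually_lt_const (half_pos hε)]
    with r hr hrB
  have hw := ofReal_mul_mem_unitDisk hζ hr
  have hk : √(1 - r) * ‖szego _ hw‖ ≤ 1 := by
    rw [← Real.sqrt_sq (norm_nonneg (szego _ hw)), norm_szego_sq hw,
      ← Real.sqrt_mul (by linarith [hr.2])]
    rw [Real.sqrt_le_one]
    rw [norm_mul, hζ, mul_one, Complex.norm_of_nonneg hr.1, ← div_eq_mul_inv,
      div_le_one (by nlinarith [hr.1, hr.2])]
    nlinarith [hr.1, hr.2]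
  have h1 : ‖inner ℂ (szego _ hw) y‖ ≤ B := by
    rw [hy, inner_sum]
    refine (norm_sum_le _ _).trans (Finset.sum_le_sum fun i _ => ?_)
    rw [lp.inner_single_right]
    refine (norm_inner_le_norm _ _).trans (mul_le_of_le_one_left (norm_nonneg _) ?_)
    simp only [szego, norm_pow, RCLike.norm_conj]
    exact pow_le_one₀ (norm_nonneg _) (mem_unitDisk.1 hw).le
  have h2 : ‖inner ℂ (szego _ hw) (hf.toL2 - y)‖ ≤ ‖szego _ hw‖ * (ε / 2) := by
    refine (norm_inner_le_norm _ _).trans ?_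
    gcongr
    rw [← dist_eq_norm, dist_comm]
    exact hs.le
  have h3 : ‖f (r * ζ)‖ ≤ B + ‖szego _ hw‖ * (ε / 2) := by
    rw [← hf.inner_szego hw, ← add_sub_cancel y hf.toL2, inner_add_right]
    exact (norm_add_le _ _).trans (add_le_add h1 h2)
  rw [dist_zero_right, Real.norm_of_nonneg (by positivity)]
  calc √(1 - r) * ‖f (r * ζ)‖ ≤ √(1 - r) * (B + ‖szego _ hw‖ * (ε / 2)) := by gcongr
    _ = √(1 - r) * B + √(1 - r) * ‖szego _ hw‖ * (ε / 2) := by ring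
    _ ≤ √(1 - r) * B + 1 * (ε / 2) := by gcongr
    _ < ε := by linarith

/-- A quotient of a polynomial by a product of linear factors with zeros on the unit circle,
growing slower than `1 / (1 - r)` radially, is a polynomial. -/
lemma eq_polynomial_of_prod_mul_eq {X : ℂ → ℂ}
    (hX : ∀ ζ : ℂ, ‖ζ‖ = 1 → Tendsto (fun r : ℝ => (1 - r) * ‖X (r * ζ)‖) (𝓝[<] 1) (𝓝 0)) :
    ∀ (N : ℕ) (ζ : Fin N → ℂ), (∀ j, ‖ζ j‖ = 1) → ∀ q : Polynomial ℂ,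
      (∀ z ∈ unitDisk, (∏ j, (z - ζ j)) * X z = q.eval z) →
      ∃ s : Polynomial ℂ, ∀ z ∈ unitDisk, X z = s.eval z := by
  intro N
  induction N with
  | zero => exact fun _ _ q hq => ⟨q, by simpa using hq⟩
  | succ N ih =>
    intro ζ hζ q hq
    have hroot : q.IsRoot (ζ 0) := by
      have l1 : Tendsto (fun r : ℝ => q.eval (r * ζ 0)) (𝓝[<] 1) (𝓝 (q.eval (ζ 0))) := by
        have : Continuous fun r : ℝ => q.eval (r * ζ 0) := by
          have := q.continuous
          fun_prop
        simpa using (this.tendsto 1).mono_left nhdsWithin_le_nhds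
      have l2 : Tendsto (fun r : ℝ => ‖∏ j : Fin N, (r * ζ 0 - ζ j.succ)‖ *
          ((1 - r) * ‖X (r * ζ 0)‖)) (𝓝[<] 1) (𝓝 0) := by
        have : Continuous fun r : ℝ => ‖∏ j : Fin N, (r * ζ 0 - ζ j.succ)‖ := by fun_prop
        simpa using ((this.tendsto 1).mono_left nhdsWithin_le_nhds).mul (hX _ (hζ 0))
      have l3 : Tendsto (fun r : ℝ => ‖q.eval (r * ζ 0)‖) (𝓝[<] 1) (𝓝 0) := by
        refine l2.congr' ?_
        filter_upwards [Ico_mem_nhdsLT (zero_lt_one' ℝ)] with r hr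
        rw [← hq _ (ofReal_mul_mem_unitDisk (hζ 0) hr), Fin.prod_univ_succ, norm_mul, norm_mul]
        have : ‖(r : ℂ) * ζ 0 - ζ 0‖ = 1 - r := by
          rw [← sub_one_mul, norm_mul, hζ 0, mul_one, ← Complex.ofReal_one, ← Complex.ofReal_sub,
            Complex.norm_real, Real.norm_of_nonpos (by linarith [hr.2])]
          ring
        rw [this]
        ring
      exact norm_eq_zero.1 (tendsto_nhds_unique l1.norm l3)
    obtain ⟨q', rfl⟩ := Polynomial.dvd_iff_isRoot.2 hroot
    refine ih (fun j => ζ j.succ) (fun j => hζ _) q' fun z hz => ?_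
    have h := hq z hz
    rw [Fin.prod_univ_succ, Polynomial.eval_mul, mul_assoc] at h
    refine mul_left_cancel₀ (sub_ne_zero.2 ?_) (by simpa using h)
    rintro rfl
    rw [mem_unitDisk, hζ 0] at hz
    exact lt_irrefl _ hz

/-- An analytic function that multiplies `H²` into `H²` is bounded. -/
lemma memHinf_of_mul_memH2 {v : ℂ → ℂ} (hv : DifferentiableOn ℂ v unitDisk)
    (hmul : ∀ g, MemH2 g → MemH2 fun z => v z * g z) : MemHinf v := by
  have hbdd : ∀ x : lp (fun _ : ℕ => ℂ) 2, ∃ C, ∀ w : unitDisk,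
      ‖((v w / ‖szego w w.2‖ : ℂ) • innerSL ℂ (szego w w.2)) x‖ ≤ C := by
    intro x
    obtain ⟨g, hg, rfl⟩ := exists_toL2_eq x
    refine ⟨‖(hmul g hg).toL2‖, fun w => ?_⟩
    have h := norm_inner_le_norm (𝕜 := ℂ) (szego w w.2) (hmul g hg).toL2
    rw [MemH2.inner_szego, norm_mul] at h
    simp only [smul_apply, innerSL_apply_apply, MemH2.inner_szego, smul_eq_mul,
      norm_mul, norm_div, Complex.norm_real, norm_norm]
    rw [div_mul_eq_mul_div, div_le_iff₀ (norm_szego_pos w.2)]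
    linarith
  obtain ⟨C, hC⟩ := banach_steinhaus hbdd
  refine ⟨hv, C, fun z hz => ?_⟩
  have := hC ⟨z, hz⟩
  rwa [norm_smul, innerSL_apply_norm, norm_div, Complex.norm_real, norm_norm,
    div_mul_cancel₀ _ (norm_szego_pos hz).ne'] at this

/-- If `v ∈ H²` and `v g` lies in `H² + (rational functions with poles among the `ζ j`)` for all
`g ∈ H²`, then `v` is bounded. -/
lemma memHinf_of_prod_mul {v : ℂ → ℂ} (hv : MemH2 v) {N : ℕ} {ζ : Fin N → ℂ}
    (hζ : ∀ j, ‖ζ j‖ = 1)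
    (hmul : ∀ g, MemH2 g → ∃ (G : ℂ → ℂ) (q : Polynomial ℂ), MemH2 G ∧ ∀ z ∈ unitDisk,
      (∏ j, (z - ζ j)) * (v z * g z) = (∏ j, (z - ζ j)) * G z + q.eval z) :
    MemHinf v := by
  refine memHinf_of_mul_memH2 hv.1 fun g hg => ?_
  obtain ⟨G, q, hG, hq⟩ := hmul g hg
  obtain ⟨s, hs⟩ := eq_polynomial_of_prod_mul_eq (X := fun z => v z * g z - G z) (fun ξ hξ => by
    have hlim : Tendsto (fun r : ℝ => (√(1 - r) * ‖v (r * ξ)‖) * (√(1 - r) * ‖g (r * ξ)‖) +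
        √(1 - r) * (√(1 - r) * ‖G (r * ξ)‖)) (𝓝[<] 1) (𝓝 0) := by
      have : Continuous fun r : ℝ => √(1 - r) := by fun_prop
      simpa using ((hv.tendsto_sqrt_mul_norm hξ).mul (hg.tendsto_sqrt_mul_norm hξ)).add
        (((this.tendsto 1).mono_left nhdsWithin_le_nhds).mul (hG.tendsto_sqrt_mul_norm hξ))
    refine squeeze_zero' ?_ ?_ hlim
    · filter_upwards [self_mem_nhdsWithin] with r (hr : r < 1)
      exact mul_nonneg (by linarith) (norm_nonneg _)
    · filter_upwards [self_mem_nhdsWithin] with r (hr : r < 1)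
      have h1 : 0 ≤ 1 - r := by linarith
      calc (1 - r) * ‖v (r * ξ) * g (r * ξ) - G (r * ξ)‖
          ≤ (1 - r) * (‖v (r * ξ)‖ * ‖g (r * ξ)‖ + ‖G (r * ξ)‖) := by
            rw [← norm_mul]
            gcongr
            exact norm_sub_le _ _
        _ = √(1 - r) * √(1 - r) * (‖v (r * ξ)‖ * ‖g (r * ξ)‖ + ‖G (r * ξ)‖) := by
            rw [Real.mul_self_sqrt h1]
        _ = _ := by ring) N ζ hζ q (fun z hz => by rw [mul_sub, hq z hz]; ring)
  exact (hG.add (memH2_polynomial s)).congr fun z hz => by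
    beta_reduce
    rw [← hs z hz]; ring

open Polynomial in
/-- The monic polynomial with zeros `ζ j`. -/
def rootsPoly {N : ℕ} (ζ : Fin N → ℂ) : ℂ[X] := ∏ j, (X - C (ζ j))

section rootsPoly

variable {N : ℕ} {ζ : Fin N → ℂ}

lemma eval_rootsPoly (ζ : Fin N → ℂ) (z : ℂ) : (rootsPoly ζ).eval z = ∏ j, (z - ζ j) := by
  simp [rootsPoly, Polynomial.eval_prod]

lemma monic_rootsPoly (ζ : Fin N → ℂ) : (rootsPoly ζ).Monic :=
  Polynomial.monic_prod_of_monic _ _ fun j _ => Polynomial.monic_X_sub_C (ζ j)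

lemma natDegree_rootsPoly (ζ : Fin N → ℂ) : (rootsPoly ζ).natDegree = N := by
  rw [rootsPoly, Polynomial.natDegree_prod_of_monic _ _
    fun j _ => Polynomial.monic_X_sub_C (ζ j)]
  simp

open Polynomial in
lemma exists_reverse_map_conj_rootsPoly :
    ∀ {N : ℕ} {ζ : Fin N → ℂ}, (∀ j, ‖ζ j‖ = 1) → ∃ c : ℂ, c ≠ 0 ∧
      ((rootsPoly ζ).map (starRingEnd ℂ)).reverse = C c * rootsPoly ζ := by
  intro N
  induction N with
  | zero => exact fun _ => ⟨1, one_ne_zero,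
      by simp [rootsPoly, ← C_1, -map_one, map_one (starRingEnd ℂ)]⟩
  | succ N ih =>
    intro ζ hζ
    obtain ⟨c, hc, h⟩ := ih (ζ := fun j => ζ j.succ) fun j => hζ _
    have h0 : (starRingEnd ℂ) (ζ 0) * ζ 0 = 1 := by
      rw [mul_comm, Complex.mul_conj, Complex.normSq_eq_norm_sq, hζ 0]
      simp
    have h1 : (starRingEnd ℂ) (ζ 0) ≠ 0 := left_ne_zero_of_mul_eq_one h0
    refine ⟨-(starRingEnd ℂ) (ζ 0) * c, mul_ne_zero (neg_ne_zero.2 h1) hc, ?_⟩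
    have hs : rootsPoly ζ = (X - C (ζ 0)) * rootsPoly fun j : Fin N => ζ j.succ := by
      simp [rootsPoly, Fin.prod_univ_succ]
    have hl : (X - C ((starRingEnd ℂ) (ζ 0))).reverse =
        C (-(starRingEnd ℂ) (ζ 0)) * (X - C (ζ 0)) := by
      ext n
      rw [coeff_reverse, natDegree_X_sub_C]
      rcases n with _ | _ | n
      · simp [h0]
      · rw [revAt_le le_rfl]
        simp
      · rw [revAt_eq_self_of_lt (by omega)]
        simp [coeff_X]
    rw [hs, Polynomial.map_mul, reverse_mul_of_domain, h, Polynomial.map_sub, map_X, map_C, hl]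
    simp only [map_neg, map_mul]
    ring

lemma exists_conj_coeff_rootsPoly (hζ : ∀ j, ‖ζ j‖ = 1) : ∃ c : ℂ, c ≠ 0 ∧
    ∀ k ≤ N, (starRingEnd ℂ) ((rootsPoly ζ).coeff k) = c * (rootsPoly ζ).coeff (N - k) := by
  obtain ⟨c, hc, h⟩ := exists_reverse_map_conj_rootsPoly hζ
  refine ⟨c, hc, fun k hk => ?_⟩
  rw [← Polynomial.coeff_C_mul, ← h, Polynomial.coeff_reverse,
    (monic_rootsPoly ζ).natDegree_map, natDegree_rootsPoly, Polynomial.revAt_le (Nat.sub_le _ _),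
    Nat.sub_sub_self hk, Polynomial.coeff_map]

lemma coef_prod_sub (ζ : Fin N → ℂ) (k : ℕ) :
    coef (fun z => ∏ j, (z - ζ j)) k = (rootsPoly ζ).coeff k := by
  simp_rw [← eval_rootsPoly]
  rw [(IsTaylor.polynomial _).coef_eq, Polynomial.coeff_coe]

/-- The coefficients of `T_{ā} f` are, up to a constant, shifted coefficients of `a f`. -/
lemma exists_tsum_conj_coef_mul_eq (hζ : ∀ j, ‖ζ j‖ = 1) : ∃ c : ℂ, c ≠ 0 ∧
    ∀ (F : PowerSeries ℂ) (n : ℕ),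
      ∑' k, (starRingEnd ℂ) (coef (fun z => ∏ j, (z - ζ j)) k) * coeff (n + k) F =
        c * coeff (n + N) (rootsPoly ζ * F : PowerSeries ℂ) := by
  obtain ⟨c, hc, h⟩ := exists_conj_coeff_rootsPoly hζ
  refine ⟨c, hc, fun F n => ?_⟩
  have hz : ∀ k, N < k → (rootsPoly ζ).coeff k = 0 := fun k hk =>
    Polynomial.coeff_eq_zero_of_natDegree_lt (by rwa [natDegree_rootsPoly])
  simp_rw [coef_prod_sub]
  rw [tsum_eq_sum (s := Finset.range (N + 1))
    fun k hk => by rw [hz k (by simpa using hk)]; simp,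
    PowerSeries.coeff_mul, Finset.Nat.sum_antidiagonal_eq_sum_range_succ_mk,
    ← Finset.sum_subset (Finset.range_mono (by omega : N + 1 ≤ (n + N).succ))
      fun k _ hk => by rw [Polynomial.coeff_coe, hz k (by simpa using hk), zero_mul],
    ← Finset.sum_range_reflect, Finset.mul_sum]
  refine Finset.sum_congr rfl fun k hk => ?_
  have hk : k ≤ N := Nat.lt_succ_iff.1 (Finset.mem_range.1 hk)
  rw [Nat.add_sub_cancel, h _ (Nat.sub_le _ _), Nat.sub_sub_self hk, ← Nat.add_sub_assoc hk,
    Polynomial.coeff_coe, mul_assoc]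

/-- `T_{ā} H² = a H² + polynomials`. -/
lemma memMbar_iff_s8 (hζ : ∀ j, ‖ζ j‖ = 1) {g : ℂ → ℂ} :
    MemMbar (fun z => ∏ j, (z - ζ j)) g ↔ ∃ (f : ℂ → ℂ) (q : Polynomial ℂ), MemH2 f ∧
      ∀ z ∈ unitDisk, g z = (∏ j, (z - ζ j)) * f z + q.eval z := by
  obtain ⟨c, hc, hT⟩ := exists_tsum_conj_coef_mul_eq hζ
  have hTbar : ∀ f, MemH2 f → ∀ z, Tbar (fun z => ∏ j, (z - ζ j)) f z =
      ∑' n, c * coeff (n + N) (rootsPoly ζ * taylorPS f : PowerSeries ℂ) * z ^ n := by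
    intro f _ z
    simp_rw [Tbar, ← hT, coeff_taylorPS]
  simp_rw [← eval_rootsPoly] at hTbar ⊢
  set P := rootsPoly ζ with hP
  constructor
  · rintro ⟨f, hf, hg⟩
    set F := taylorPS f with hF
    set G : PowerSeries ℂ := PowerSeries.mk fun n => coeff (n + N) F with hG
    have hFG : F = PowerSeries.X ^ N * G + (F.trunc N : PowerSeries ℂ) :=
      F.eq_X_pow_mul_shift_add_trunc N
    obtain ⟨f', hf', hGf⟩ := exists_memH2_of_summable (F := G) <| by
      simp only [hG, PowerSeries.coeff_mk, hF, coeff_taylorPS]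
      exact (summable_nat_add_iff N).2 hf.2
    let q : Polynomial ℂ := Polynomial.divX^[N] (P * F.trunc N)
    have hq : ∀ n, q.coeff n = (P * F.trunc N).coeff (n + N) := by
      intro n
      suffices ∀ (m : ℕ) (p : Polynomial ℂ) n, (Polynomial.divX^[m] p).coeff n = p.coeff (n + m) from
        this N _ n
      intro m
      induction m with
      | zero => simp
      | succ m ih =>
        intro p n
        rw [Function.iterate_succ_apply, ih, Polynomial.coeff_divX, add_assoc]
    refine ⟨fun z => c * f' z, Polynomial.C c * q, ?_, fun z hz => ?_⟩
    · simpa using (memHinf_polynomial (Polynomial.C c)).mul_memH2 hf'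
    · rw [hg hz, hTbar f hf]
      have h1 := ((IsTaylor.polynomial (Polynomial.C c)).mul
        (((IsTaylor.polynomial P).mul hGf).add (IsTaylor.polynomial q))) z hz
      convert! h1.tsum_eq using 1
      · refine tsum_congr fun n => ?_
        have e : (P * F : PowerSeries ℂ) =
            PowerSeries.X ^ N * ((P : PowerSeries ℂ) * G) +
              ((P * F.trunc N : Polynomial ℂ) : PowerSeries ℂ) := by
          rw [Polynomial.coe_mul, mul_left_comm, ← mul_add, ← hFG]
        rw [Polynomial.coe_C, PowerSeries.coeff_C_mul, map_add, Polynomial.coeff_coe q, hq, e,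
          map_add, PowerSeries.coeff_X_pow_mul, Polynomial.coeff_coe]
      · simp
        ring
  · rintro ⟨f, q, hf, hg⟩
    let s := (Polynomial.X ^ N * q) /ₘ P
    let r := (Polynomial.X ^ N * q) %ₘ P
    have hsr : r + P * s = Polynomial.X ^ N * q := Polynomial.modByMonic_add_div _ P
    have hr : ∀ n, r.coeff (n + N) = 0 := fun n => by
      refine Polynomial.coeff_eq_zero_of_degree_lt
        ((Polynomial.degree_modByMonic_lt _ (monic_rootsPoly ζ)).trans_le ?_)
      rw [Polynomial.degree_eq_natDegree (monic_rootsPoly ζ).ne_zero, natDegree_rootsPoly]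
      exact_mod_cast Nat.le_add_left N n
    have hF := isTaylor_taylorPS hf.1
    have hu := (IsTaylor.polynomial (Polynomial.C c⁻¹)).mul
      ((IsTaylor.polynomial s).add ((IsTaylor.polynomial (Polynomial.X ^ N)).mul hF))
    refine ⟨fun z => (Polynomial.C c⁻¹).eval z *
        (s.eval z + (Polynomial.X ^ N : Polynomial ℂ).eval z * f z), ?_, fun z hz => ?_⟩
    · exact (memHinf_polynomial _).mul_memH2
        ((memH2_polynomial s).add ((memHinf_polynomial _).mul_memH2 hf))
    · rw [hTbar _ ((memHinf_polynomial _).mul_memH2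
        ((memH2_polynomial s).add ((memHinf_polynomial _).mul_memH2 hf))), hu.taylorPS_eq, hg z hz]
      have h1 := (((IsTaylor.polynomial P).mul hF).add (IsTaylor.polynomial q)) z hz
      refine h1.tsum_eq.symm.trans ?_
      refine tsum_congr fun n => ?_
      have e : (P : PowerSeries ℂ) * (((Polynomial.C c⁻¹ : Polynomial ℂ) : PowerSeries ℂ) *
          ((s : PowerSeries ℂ) + ((Polynomial.X ^ N : Polynomial ℂ) : PowerSeries ℂ) *
            taylorPS f)) = PowerSeries.C c⁻¹ * (PowerSeries.X ^ N *
              ((P : PowerSeries ℂ) * taylorPS f + (q : PowerSeries ℂ)) - (r : PowerSeries ℂ)) := by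
        have := congrArg (fun p : Polynomial ℂ => (p : PowerSeries ℂ)) hsr
        simp only [Polynomial.coe_add, Polynomial.coe_mul, Polynomial.coe_pow, Polynomial.coe_X]
          at this
        rw [Polynomial.coe_C, Polynomial.coe_pow, Polynomial.coe_X]
        linear_combination PowerSeries.C c⁻¹ * this
      rw [e, PowerSeries.coeff_C_mul, map_sub, PowerSeries.coeff_X_pow_mul, Polynomial.coeff_coe r,
        hr, sub_zero, mul_inv_cancel_left₀ hc]

end rootsPoly

/-- for polynomials `a₁, a₂` with all zeros on the unit circle and
`h = a₁/a₂ ∈ H^∞`, the multipliers from `M(ā₁)` to `M(ā₂)` are exactly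
`{φ ∈ M(ā₂) : hφ ∈ H^∞}`. -/
theorem stmt8 (N₁ N₂ : ℕ) (ζ₁ : Fin N₁ → ℂ) (ζ₂ : Fin N₂ → ℂ)
    (hζ₁ : ∀ j, ‖ζ₁ j‖ = 1) (hζ₂ : ∀ j, ‖ζ₂ j‖ = 1)
    (h : ℂ → ℂ) (hh : MemHinf h)
    (hdiv : ∀ z ∈ unitDisk, (∏ j, (z - ζ₁ j)) = (∏ j, (z - ζ₂ j)) * h z)
    (φ : ℂ → ℂ) :
    Mult (fun z => ∏ j, (z - ζ₁ j)) (fun z => ∏ j, (z - ζ₂ j)) φ ↔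
      DifferentiableOn ℂ φ unitDisk ∧
        MemMbar (fun z => ∏ j, (z - ζ₂ j)) φ ∧
        MemHinf fun z => h z * φ z := by
  simp only [Mult, memMbar_iff_s8 hζ₁, memMbar_iff_s8 hζ₂]
  refine and_congr_right fun hφ => ⟨fun hM => ?_, ?_⟩
  · obtain ⟨ψ, p, hψ, hp⟩ := hM (fun _ => 1)
      ⟨fun _ => 0, 1, by simpa using memH2_polynomial 0, by simp⟩
    simp only [mul_one] at hp
    refine ⟨⟨ψ, p, hψ, hp⟩, memHinf_of_prod_mul (hh.mul_memH2 ?_) hζ₂ fun g hg => ?_⟩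
    · refine (((memHinf_polynomial (rootsPoly ζ₂)).mul_memH2 hψ).add
        (memH2_polynomial p)).congr fun z hz => ?_
      rw [hp z hz, ← eval_rootsPoly]
    · obtain ⟨G, q, hG, hq⟩ := hM (fun z => (∏ j, (z - ζ₁ j)) * g z)
        ⟨g, 0, hg, by simp⟩
      refine ⟨G, q, hG, fun z hz => ?_⟩
      rw [← hq z hz, hdiv z hz]
      ring
  · rintro ⟨⟨ψ, p, hψ, hp⟩, hb⟩ f ⟨g, q, hg, hf⟩
    refine ⟨_, p * q, (hb.mul_memH2 hg).add ((memHinf_polynomial q).mul_memH2 hψ),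
      fun z hz => ?_⟩
    rw [hf z hz, hdiv z hz, Polynomial.eval_mul, mul_add, hp z hz]
    ring
end
end
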